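/- Let N ≥ 2 and n ≥ 1 be integers, let α₁, …, α_n be integers each coprime to N, and let u₁, …, u_n be real numbers. Set 𝒟(N,n) = Π_{p ∣ N, p prime} p^{⌊n/(p−1)⌋}. Then 𝒟(N,n) · ( N · Σ_{q ∈ Q} Π_{j=1}^{n} b₁((u_j + q_j)/N) − Π_{j=1}^{n} b₁(u_j) ) is an integer. -/

import Mathlib

/-- The periodic Bernoulli function `b_k(x) = B_k(x - ⌊x⌋)`. -/
noncomputable def periodicBernoulli (k : ℕ) (x : ℝ) : ℝ :=
  Polynomial.aeval (Int.fract x) (Polynomial.bernoulli k)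

section

open Finset

/-- If `ζ ≠ 1` is integral, then `1 - ζ` divides `1 - ζ ^ i` among the algebraic integers. -/
lemma isIntegral_one_sub_pow_div {ζ : ℂ} (hζ : IsIntegral ℤ ζ) (h1 : ζ ≠ 1) (i : ℕ) :
    IsIntegral ℤ ((1 - ζ ^ i) / (1 - ζ)) := by
  rw [← mul_neg_geom_sum, mul_div_cancel_left₀ _ (sub_ne_zero.2 h1.symm)]
  exact IsIntegral.sum _ fun j _ => hζ.pow j

/-- If the prime `p` divides the order of the root of unity `ζ`, then `(1 - ζ) ^ (p - 1)`
divides `p` among the algebraic integers. -/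
lemma IsPrimitiveRoot.isIntegral_prime_div_one_sub_pow {ζ : ℂ} {d p : ℕ}
    (hζ : IsPrimitiveRoot ζ d) (hd : 0 < d) (hp : p.Prime) (hpd : p ∣ d) :
    IsIntegral ℤ ((p : ℂ) / (1 - ζ) ^ (p - 1)) := by
  have : Fact p.Prime := ⟨hp⟩
  have : NeZero d := ⟨hd.ne'⟩
  have h1 : ζ ≠ 1 := by
    rintro rfl
    have := hζ.eq_orderOf
    rw [orderOf_one] at this
    exact hp.one_lt.ne' (Nat.dvd_one.1 (this ▸ hpd))
  have hω : IsPrimitiveRoot (Complex.exp (2 * Real.pi * Complex.I / p)) p :=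
    Complex.isPrimitiveRoot_exp p hp.ne_zero
  have hprod : (p : ℂ) = ∏ μ ∈ primitiveRoots p ℂ, (1 - μ) := by
    have h := congrArg (Polynomial.eval 1) (Polynomial.cyclotomic_eq_prod_X_sub_primitiveRoots hω)
    rw [Polynomial.eval_one_cyclotomic_prime, Polynomial.eval_prod] at h
    simpa using h
  have hcard : (primitiveRoots p ℂ).card = p - 1 := by
    rw [hω.card_primitiveRoots, Nat.totient_prime hp]
  rw [hprod, ← hcard, ← prod_const, ← prod_div_distrib]
  refine IsIntegral.prod _ fun μ hμ => ?_
  obtain ⟨c, rfl⟩ := hpd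
  obtain ⟨i, -, rfl⟩ := hζ.eq_pow_of_pow_eq_one
    (show μ ^ (p * c) = 1 by
      rw [pow_mul, ((mem_primitiveRoots hp.pos).1 hμ).pow_eq_one, one_pow])
  exact isIntegral_one_sub_pow_div (hζ.isIntegral hd) h1 i

/-- For an `N`-th root of unity `ζ ≠ 1`, the product of the numbers `p ^ (1 / (p - 1))` over the
primes `p` dividing `N` is a multiple of `ζ - 1` among the algebraic integers. -/
lemma isIntegral_prod_radical_div_sub_one {r : ℕ → ℂ} (hr : ∀ p, p.Prime → r p ^ (p - 1) = p)
    {N : ℕ} (hN : N ≠ 0) {ζ : ℂ} (hζ : ζ ^ N = 1) (h1 : ζ ≠ 1) :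
    IsIntegral ℤ ((∏ p ∈ N.primeFactors, r p) / (ζ - 1)) := by
  have hd : orderOf ζ ∣ N := orderOf_dvd_of_pow_eq_one hζ
  obtain ⟨p, hp, hpd⟩ := Nat.exists_prime_and_dvd (mt orderOf_eq_one_iff.1 h1)
  have hpos (q : ℕ) (hq : q.Prime) : 0 < q - 1 := Nat.sub_pos_of_lt hq.one_lt
  have hrint (q : ℕ) (hq : q.Prime) : IsIntegral ℤ (r q) := by
    refine IsIntegral.of_pow (hpos q hq) ?_
    rw [hr q hq]
    exact isIntegral_algebraMap (x := (q : ℤ))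
  have hdiv : IsIntegral ℤ (r p / (1 - ζ)) := by
    refine IsIntegral.of_pow (hpos p hp) ?_
    rw [div_pow, hr p hp]
    exact (IsPrimitiveRoot.orderOf ζ).isIntegral_prime_div_one_sub_pow
      (Nat.pos_of_dvd_of_pos hd (Nat.pos_of_ne_zero hN)) hp hpd
  have hmem : p ∈ N.primeFactors := Nat.mem_primeFactors.2 ⟨hp, hpd.trans hd, hN⟩
  rw [← mul_prod_erase _ _ hmem, mul_div_right_comm, ← neg_sub, div_neg, neg_mul]
  exact (hdiv.mul (IsIntegral.prod _ fun q hq =>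
    hrint q (Nat.prime_of_mem_primeFactors (mem_of_mem_erase hq)))).neg

/-- The sum of a periodic function over one period does not depend on the starting point. -/
lemma sum_range_add_of_periodic {M : Type*} [AddCommGroup M] {h : ℤ → M} {N : ℕ}
    (hh : ∀ m, h (m + N) = h m) (a : ℤ) :
    ∑ q ∈ range N, h (q + a) = ∑ q ∈ range N, h q := by
  have step (a : ℤ) : ∑ q ∈ range N, h (q + (a + 1)) = ∑ q ∈ range N, h (q + a) := by
    have h1 := sum_range_succ (fun q : ℕ => h (q + a)) N
    have h2 := sum_range_succ' (fun q : ℕ => h (q + a)) N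
    rw [h1] at h2
    simp only [Nat.cast_add, Nat.cast_one, Nat.cast_zero, zero_add, add_comm (N : ℤ), hh] at h2
    rw [add_right_cancel_iff] at h2
    rw [h2]
    exact sum_congr rfl fun q _ => by congr 1; ring
  induction a using Int.induction_on with
  | zero => simp
  | succ i ih => rw [step, ih]
  | pred i ih =>
    rw [← step, sub_add_cancel]
    exact ih

lemma periodicBernoulli_one (x : ℝ) : periodicBernoulli 1 x = Int.fract x - 1 / 2 := by
  simp [periodicBernoulli, Polynomial.bernoulli_one]

lemma periodicBernoulli_one_div {N q : ℕ} (hq : q < N) (u : ℝ) :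
    periodicBernoulli 1 ((u + ((q - ⌊u⌋ : ℤ) : ℝ)) / N) = (Int.fract u + q) / N - 1 / 2 := by
  have hN : (0 : ℝ) < N := by exact_mod_cast (Nat.zero_le q).trans_lt hq
  have hq' : (q : ℝ) + 1 ≤ N := by exact_mod_cast hq
  have e : u + ((q - ⌊u⌋ : ℤ) : ℝ) = Int.fract u + q := by
    push_cast
    rw [← Int.self_sub_floor]
    ring
  rw [periodicBernoulli_one, e, Int.fract_eq_self.2]
  have h0 := Int.fract_nonneg u
  have h1 := Int.fract_lt_one u
  refine ⟨by positivity, ?_⟩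
  rw [div_lt_one hN]
  linarith

/-- Multiplication by `ζ - 1` evaluates the arithmetic-geometric sum. -/
lemma sum_range_mul_pow_mul_sub_one (ζ : ℂ) (N : ℕ) :
    (∑ q ∈ range N, (q : ℂ) * ζ ^ q) * (ζ - 1) = N * ζ ^ N - ζ * ∑ q ∈ range N, ζ ^ q := by
  induction N with
  | zero => simp
  | succ N ih =>
    rw [sum_range_succ, sum_range_succ, add_mul, ih]
    push_cast
    ring

lemma sum_periodicBernoulli_one_mul_zpow {N : ℕ} (hN : N ≠ 0) {ζ : ℂ} (hζ : ζ ^ N = 1) (u : ℝ) :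
    ∑ q ∈ range N, (periodicBernoulli 1 ((u + (q : ℝ)) / N) : ℂ) * ζ ^ q =
      ζ ^ (-⌊u⌋) * ∑ q ∈ range N, (((Int.fract u + q) / N - 1 / 2 : ℝ) : ℂ) * ζ ^ q := by
  have hN' : (N : ℝ) ≠ 0 := Nat.cast_ne_zero.2 hN
  have h0 : ζ ≠ 0 := by
    rintro rfl
    simp [hN] at hζ
  have hper (m : ℤ) : (periodicBernoulli 1 ((u + ((m + N : ℤ) : ℝ)) / N) : ℂ) * ζ ^ (m + N : ℤ) =
      (periodicBernoulli 1 ((u + (m : ℝ)) / N) : ℂ) * ζ ^ m := by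
    have : (u + ((m + N : ℤ) : ℝ)) / N = (u + m) / N + 1 := by
      push_cast
      field_simp
      ring
    rw [periodicBernoulli_one, periodicBernoulli_one, this, Int.fract_add_one, zpow_add₀ h0,
      zpow_natCast, hζ, mul_one]
  have hshift := sum_range_add_of_periodic
    (h := fun m : ℤ => (periodicBernoulli 1 ((u + (m : ℝ)) / N) : ℂ) * ζ ^ m) hper (-⌊u⌋)
  simp only [Int.cast_natCast, zpow_natCast] at hshift
  rw [← hshift, mul_sum]
  refine sum_congr rfl fun q hq => ?_
  rw [← periodicBernoulli_one_div (mem_range.1 hq) u, zpow_add₀ h0, zpow_natCast, sub_eq_add_neg]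
  ring

/-- The finite Fourier coefficients of `b₁` at nontrivial roots of unity. -/
lemma sum_periodicBernoulli_one_mul_pow {N : ℕ} (hN : N ≠ 0) {ζ : ℂ} (hζ : ζ ^ N = 1)
    (h1 : ζ ≠ 1) (u : ℝ) :
    ∑ q ∈ range N, (periodicBernoulli 1 ((u + (q : ℝ)) / N) : ℂ) * ζ ^ q =
      ζ ^ (-⌊u⌋) / (ζ - 1) := by
  have hN' : (N : ℂ) ≠ 0 := Nat.cast_ne_zero.2 hN
  have hsub : ζ - 1 ≠ 0 := sub_ne_zero.2 h1
  have hgeom : ∑ q ∈ range N, ζ ^ q = 0 := by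
    rw [geom_sum_eq h1, hζ, sub_self, zero_div]
  have harith : ∑ q ∈ range N, (q : ℂ) * ζ ^ q = N / (ζ - 1) := by
    rw [eq_div_iff hsub, sum_range_mul_pow_mul_sub_one, hζ, hgeom]
    ring
  have hsplit : ∑ q ∈ range N, (((Int.fract u + q) / N - 1 / 2 : ℝ) : ℂ) * ζ ^ q =
      (((Int.fract u : ℝ) : ℂ) / N - 1 / 2) * ∑ q ∈ range N, ζ ^ q +
        1 / N * ∑ q ∈ range N, (q : ℂ) * ζ ^ q := by
    rw [mul_sum, mul_sum, ← sum_add_distrib]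
    refine sum_congr rfl fun q _ => ?_
    push_cast
    ring
  rw [sum_periodicBernoulli_one_mul_zpow hN hζ, hsplit, hgeom, harith]
  field_simp
  ring

/-- The distribution relation for `b₁`. -/
lemma sum_periodicBernoulli_one {N : ℕ} (hN : N ≠ 0) (u : ℝ) :
    ∑ q ∈ range N, (periodicBernoulli 1 ((u + (q : ℝ)) / N) : ℂ) = periodicBernoulli 1 u := by
  have hN' : (N : ℂ) ≠ 0 := Nat.cast_ne_zero.2 hN
  have h := sum_periodicBernoulli_one_mul_zpow hN (one_pow N) u
  simp only [one_pow, one_zpow, mul_one, one_mul] at h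
  have hid : (∑ q ∈ range N, (q : ℂ)) * 2 = N * (N - 1) := by
    have := sum_range_id_mul_two N
    have hc := congrArg (Nat.cast : ℕ → ℂ) this
    push_cast [Nat.cast_sub (Nat.one_le_iff_ne_zero.2 hN)] at hc
    exact hc
  have hid' : ∑ q ∈ range N, (q : ℂ) = N * (N - 1) / 2 := by
    rw [← hid]
    ring
  rw [h, periodicBernoulli_one]
  push_cast
  rw [sum_sub_distrib, ← sum_div, sum_add_distrib, hid']
  simp only [sum_const, card_range, nsmul_eq_mul]
  field_simp
  ring

/-- Detecting divisibility by `N` with the powers of a primitive `N`-th root of unity. -/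
lemma IsPrimitiveRoot.sum_zpow_pow_eq_ite {e : ℂ} {N : ℕ} (he : IsPrimitiveRoot e N) (m : ℤ) :
    ∑ k ∈ range N, (e ^ m) ^ k = if (N : ℤ) ∣ m then (N : ℂ) else 0 := by
  split_ifs with h
  · simp [(he.zpow_eq_one_iff_dvd m).2 h]
  · rw [geom_sum_eq (mt (he.zpow_eq_one_iff_dvd m).1 h), ← zpow_natCast, ← zpow_mul, mul_comm,
      zpow_mul, zpow_natCast, he.pow_eq_one, one_zpow, sub_self, zero_div]

/-- Finite Fourier expansion of a sum over the solutions of a linear congruence. -/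
lemma IsPrimitiveRoot.card_mul_sum_filter_dvd {e : ℂ} {N n : ℕ} (hN : N ≠ 0)
    (he : IsPrimitiveRoot e N) (α : Fin n → ℤ) (f : Fin n → ℕ → ℂ) :
    (N : ℂ) * ∑ q ∈ univ.filter
        (fun q : Fin n → Fin N => (N : ℤ) ∣ ∑ j, ((q j : ℕ) : ℤ) * α j), ∏ j, f j (q j) =
      ∑ k ∈ range N, ∏ j, ∑ q ∈ range N, f j q * ((e ^ α j) ^ k) ^ q := by
  have h0 : e ≠ 0 := he.ne_zero hN
  have hpow (k : ℕ) (q : Fin n → Fin N) :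
      (e ^ (∑ j, ((q j : ℕ) : ℤ) * α j)) ^ k = ∏ j, ((e ^ α j) ^ k) ^ (q j : ℕ) := by
    have hsum (s : Finset (Fin n)) :
        e ^ (∑ j ∈ s, ((q j : ℕ) : ℤ) * α j) = ∏ j ∈ s, e ^ (((q j : ℕ) : ℤ) * α j) := by
      induction s using Finset.induction_on with
      | empty => simp
      | insert a s ha ih => rw [sum_insert ha, prod_insert ha, zpow_add₀ h0, ih]
    rw [hsum, ← prod_pow]
    refine prod_congr rfl fun j _ => ?_
    rw [mul_comm, zpow_mul, zpow_natCast, pow_right_comm]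
  calc _ = ∑ q : Fin n → Fin N, (∏ j, f j (q j)) *
        ∑ k ∈ range N, (e ^ (∑ j, ((q j : ℕ) : ℤ) * α j)) ^ k := by
        simp only [he.sum_zpow_pow_eq_ite, mul_ite, mul_zero, sum_filter, sum_mul, ite_mul, zero_mul,
          mul_comm (N : ℂ)]
    _ = ∑ k ∈ range N, ∑ q : Fin n → Fin N, ∏ j, f j (q j) * ((e ^ α j) ^ k) ^ (q j : ℕ) := by
        simp only [mul_sum, hpow, prod_mul_distrib]
        exact sum_comm
    _ = _ := by
        refine sum_congr rfl fun k _ => ?_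
        simp only [← Fin.sum_univ_eq_sum_range (n := N)
          (f := fun q => f _ q * ((e ^ α _) ^ k) ^ q)]
        rw [prod_univ_sum, Fintype.piFinset_univ]

/-- The smoothed Dedekind-type sum attached to `N`, `α` and `u`. -/
noncomputable def smoothedSum (N : ℕ) {n : ℕ} (α : Fin n → ℤ) (u : Fin n → ℝ) : ℝ :=
  (N : ℝ) * ∑ q ∈ univ.filter
      (fun q : Fin n → Fin N => (N : ℤ) ∣ ∑ j, ((q j : ℕ) : ℤ) * α j),
    ∏ j, periodicBernoulli 1 ((u j + ((q j : ℕ) : ℝ)) / N) - ∏ j, periodicBernoulli 1 (u j)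

lemma IsPrimitiveRoot.zpow_pow_ne_one {e : ℂ} {N : ℕ} (he : IsPrimitiveRoot e N) {a : ℤ}
    (ha : IsCoprime a (N : ℤ)) {k : ℕ} (hk0 : k ≠ 0) (hk : k < N) : (e ^ a) ^ k ≠ 1 := by
  rw [← zpow_natCast, ← zpow_mul, Ne, he.zpow_eq_one_iff_dvd]
  intro h
  have hdvd : N ∣ k := Int.natCast_dvd_natCast.1 (ha.symm.dvd_of_dvd_mul_left h)
  exact hk.not_ge (Nat.le_of_dvd (Nat.pos_of_ne_zero hk0) hdvd)

lemma zpow_pow_pow_eq_one {e : ℂ} {N : ℕ} (he : e ^ N = 1) (a : ℤ) (k : ℕ) :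
    ((e ^ a) ^ k) ^ N = 1 := by
  rw [pow_right_comm, ← zpow_natCast (e ^ a) N, zpow_comm, zpow_natCast, he, one_zpow, one_pow]

/-- The smoothed sum as a sum over the nontrivial `N`-th roots of unity. -/
lemma IsPrimitiveRoot.smoothedSum_eq {e : ℂ} {N n : ℕ} (hN : N ≠ 0) (he : IsPrimitiveRoot e N)
    {α : Fin n → ℤ} (hα : ∀ j, IsCoprime (α j) (N : ℤ)) (u : Fin n → ℝ) :
    (smoothedSum N α u : ℂ) = ∑ k ∈ (range N).erase 0,
      ∏ j, ((e ^ α j) ^ k) ^ (-⌊u j⌋) / ((e ^ α j) ^ k - 1) := by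
  have hfour := he.card_mul_sum_filter_dvd hN α
    (fun j q => (periodicBernoulli 1 ((u j + (q : ℝ)) / N) : ℂ))
  rw [smoothedSum]
  push_cast
  rw [hfour, ← add_sum_erase _ _ (mem_range.2 (Nat.pos_of_ne_zero hN))]
  simp only [pow_zero, one_pow, mul_one, sum_periodicBernoulli_one hN, add_sub_cancel_left]
  refine sum_congr rfl fun k hk => prod_congr rfl fun j _ => ?_
  rw [mem_erase, mem_range] at hk
  exact sum_periodicBernoulli_one_mul_pow hN (zpow_pow_pow_eq_one he.pow_eq_one _ _)
    (he.zpow_pow_ne_one (hα j) hk.1 hk.2) (u j)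

lemma exists_rat_periodicBernoulli_one (x : ℚ) :
    ∃ y : ℚ, periodicBernoulli 1 (x : ℝ) = y :=
  ⟨Int.fract x - 1 / 2, by rw [periodicBernoulli_one]; push_cast; rfl⟩

lemma exists_rat_smoothedSum_eq {N n : ℕ} (hN : N ≠ 0)
    {α : Fin n → ℤ} (hα : ∀ j, IsCoprime (α j) (N : ℤ)) (u : Fin n → ℝ) :
    ∃ x : ℚ, smoothedSum N α u = x := by
  have he := Complex.isPrimitiveRoot_exp N hN
  have hfloor : smoothedSum N α u = smoothedSum N α fun j => (⌊u j⌋ : ℝ) := by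
    rw [← Complex.ofReal_inj, he.smoothedSum_eq hN hα, he.smoothedSum_eq hN hα]
    simp only [Int.floor_intCast]
  choose b hb using exists_rat_periodicBernoulli_one
  rw [hfloor]
  refine ⟨(N : ℚ) * ∑ q ∈ univ.filter
      (fun q : Fin n → Fin N => (N : ℤ) ∣ ∑ j, ((q j : ℕ) : ℤ) * α j),
    ∏ j, b ((⌊u j⌋ + ((q j : ℕ) : ℚ)) / N) - ∏ j, b ⌊u j⌋, ?_⟩
  rw [smoothedSum]
  push_cast
  simp only [← hb]
  push_cast
  rfl

/-- The denominator of the smoothed sum divides `∏ p ^ (n / (p - 1))`, with real exponents. -/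
lemma isIntegral_prod_radical_pow_mul_smoothedSum {r : ℕ → ℂ}
    (hr : ∀ p, p.Prime → r p ^ (p - 1) = p) {N n : ℕ} (hN : N ≠ 0)
    {α : Fin n → ℤ} (hα : ∀ j, IsCoprime (α j) (N : ℤ)) (u : Fin n → ℝ) :
    IsIntegral ℤ ((∏ p ∈ N.primeFactors, r p) ^ n * (smoothedSum N α u : ℂ)) := by
  have he := Complex.isPrimitiveRoot_exp N hN
  rw [he.smoothedSum_eq hN hα, mul_sum]
  refine IsIntegral.sum _ fun k hk => ?_
  rw [mem_erase, mem_range] at hk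
  rw [← Fin.prod_const n, ← prod_mul_distrib]
  refine IsIntegral.prod _ fun j _ => ?_
  rw [mul_div_left_comm]
  have hroot := zpow_pow_pow_eq_one he.pow_eq_one (α j) k
  refine IsIntegral.mul (IsIntegral.of_pow (Nat.pos_of_ne_zero hN) ?_)
    (isIntegral_prod_radical_div_sub_one hr hN hroot (he.zpow_pow_ne_one (hα j) hk.1 hk.2))
  rw [← zpow_natCast, zpow_comm, zpow_natCast, hroot, one_zpow]
  exact isIntegral_one

lemma Nat.factorization_prod_primeFactors_pow {N p : ℕ} (hp : p ∈ N.primeFactors) (g : ℕ → ℕ) :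
    (∏ q ∈ N.primeFactors, q ^ g q).factorization p = g p := by
  rw [Nat.factorization_prod fun q hq => pow_ne_zero _ (Nat.prime_of_mem_primeFactors hq).ne_zero,
    Finsupp.finsetSum_apply, sum_eq_single p]
  · simp [(Nat.prime_of_mem_primeFactors hp).factorization_self]
  · intro q hq hqp
    simp [(Nat.prime_of_mem_primeFactors hq).factorization, hqp]
  · exact fun h => (h hp).elim

lemma dvd_prod_primeFactors_pow_div {N n M b : ℕ} (hM : M ≠ 0) (hb : b ≠ 0)
    (hdiv : ∀ p ∈ N.primeFactors, p - 1 ∣ M)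
    (h : b ^ M ∣ ∏ p ∈ N.primeFactors, p ^ (M / (p - 1) * n)) :
    b ∣ ∏ p ∈ N.primeFactors, p ^ (n / (p - 1)) := by
  have hne (g : ℕ → ℕ) : ∏ p ∈ N.primeFactors, p ^ g p ≠ 0 :=
    prod_ne_zero_iff.2 fun q hq => pow_ne_zero _ (Nat.prime_of_mem_primeFactors hq).ne_zero
  refine (Nat.factorization_prime_le_iff_dvd hb (hne _)).1 fun p hp => ?_
  by_cases hpN : p ∈ N.primeFactors
  · have hle := (Nat.factorization_prime_le_iff_dvd (pow_ne_zero _ hb) (hne _)).2 h p hp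
    rw [Nat.factorization_prod_primeFactors_pow hpN, Nat.factorization_pow, Finsupp.smul_apply,
      smul_eq_mul] at hle
    rw [Nat.factorization_prod_primeFactors_pow hpN,
      Nat.le_div_iff_mul_le (Nat.sub_pos_of_lt hp.one_lt)]
    obtain ⟨c, rfl⟩ := hdiv p hpN
    rw [Nat.mul_div_cancel_left _ (Nat.sub_pos_of_lt hp.one_lt)] at hle
    refine Nat.le_of_mul_le_mul_left (c := c) ?_ (Nat.pos_of_ne_zero (right_ne_zero_of_mul hM))
    linarith
  · have hpb : ¬ p ∣ b := fun hpb => by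
      obtain ⟨q, hq, hpq⟩ := (hp.prime.dvd_finsetProd_iff _).1
        ((dvd_pow hpb hM).trans h)
      have := (Nat.prime_dvd_prime_iff_eq hp (Nat.prime_of_mem_primeFactors hq)).1
        (hp.dvd_of_dvd_pow hpq)
      exact hpN (this ▸ hq)
    rw [Nat.factorization_eq_zero_of_not_dvd hpb]
    exact Nat.zero_le _

lemma Rat.den_pow_dvd_of_natCast_mul_pow_eq_intCast {x : ℚ} {m M : ℕ} {z : ℤ}
    (h : (m : ℚ) * x ^ M = z) : x.den ^ M ∣ m := by
  have hd : (x.den : ℚ) ≠ 0 := Nat.cast_ne_zero.2 x.den_ne_zero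
  have hnum : (m : ℤ) * x.num ^ M = z * (x.den : ℤ) ^ M := by
    have h' : (m : ℚ) * x.num ^ M = z * (x.den : ℚ) ^ M := by
      rw [← h, mul_assoc, ← mul_pow, Rat.mul_den_eq_num]
    exact_mod_cast h'
  have hcop : IsCoprime ((x.den : ℤ) ^ M) (x.num ^ M) :=
    (Rat.isCoprime_num_den x).symm.pow
  exact_mod_cast hcop.dvd_of_dvd_mul_right (Dvd.intro_left z hnum.symm)

/-- The denominator of the smoothed sum divides `∏ p ^ ⌊n / (p - 1)⌋`. -/
theorem exists_int_prod_mul_smoothedSum_eq {N n : ℕ} (hN : N ≠ 0)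
    {α : Fin n → ℤ} (hα : ∀ j, IsCoprime (α j) (N : ℤ)) (u : Fin n → ℝ) :
    ∃ z : ℤ, ((∏ p ∈ N.primeFactors, p ^ (n / (p - 1)) : ℕ) : ℝ) * smoothedSum N α u = z := by
  obtain ⟨x, hx⟩ := exists_rat_smoothedSum_eq hN hα u
  have hroots (p : ℕ) : ∃ r : ℂ, p.Prime → r ^ (p - 1) = p := by
    by_cases hp : p.Prime
    · obtain ⟨r, hr⟩ := IsAlgClosed.exists_pow_nat_eq (p : ℂ) (Nat.sub_pos_of_lt hp.one_lt)
      exact ⟨r, fun _ => hr⟩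
    · exact ⟨0, fun h => (hp h).elim⟩
  choose r hr using hroots
  let M : ℕ := ∏ p ∈ N.primeFactors, (p - 1)
  have hM : M ≠ 0 := prod_ne_zero_iff.2 fun p hp =>
    (Nat.sub_pos_of_lt (Nat.prime_of_mem_primeFactors hp).one_lt).ne'
  have hdiv (p : ℕ) (hp : p ∈ N.primeFactors) : p - 1 ∣ M := dvd_prod_of_mem (fun p => p - 1) hp
  have hint := (isIntegral_prod_radical_pow_mul_smoothedSum hr hN hα u).pow M
  have heq : ((∏ p ∈ N.primeFactors, r p) ^ n * (smoothedSum N α u : ℂ)) ^ M =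
      (((∏ p ∈ N.primeFactors, p ^ (M / (p - 1) * n) : ℕ) * x ^ M : ℚ) : ℂ) := by
    rw [mul_pow, hx]
    push_cast
    congr 1
    rw [← pow_mul, ← prod_pow]
    refine prod_congr rfl fun p hp => ?_
    rw [← hr p (Nat.prime_of_mem_primeFactors hp), ← pow_mul, ← mul_assoc,
      Nat.mul_div_cancel' (hdiv p hp), mul_comm n]
  rw [heq] at hint
  obtain ⟨z, hz⟩ := (IsIntegral.exists_int_iff_exists_rat hint).1 ⟨_, rfl⟩
  obtain ⟨c, hc⟩ := dvd_prod_primeFactors_pow_div hM x.den_ne_zero hdiv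
    (Rat.den_pow_dvd_of_natCast_mul_pow_eq_intCast (by exact_mod_cast hz))
  refine ⟨c * x.num, ?_⟩
  rw [hx, hc, ← Rat.cast_natCast, ← Rat.cast_intCast, ← Rat.cast_mul, Rat.cast_inj]
  push_cast
  rw [← Rat.mul_den_eq_num x]
  ring

end

/-- the smoothed Dedekind-type sum over
`Q = {q ∈ {0,…,N-1}^n : N ∣ ∑ q_j α_j}` has denominator dividing
`𝒟(N,n) = ∏_{p ∣ N} p^{⌊n/(p-1)⌋}`. -/
theorem stmt6 (N n : ℕ) (hN : 2 ≤ N) (hn : 1 ≤ n)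
    (α : Fin n → ℤ) (hα : ∀ j, IsCoprime (α j) (N : ℤ))
    (u : Fin n → ℝ) :
    ∃ z : ℤ,
      ((∏ p ∈ N.primeFactors, p ^ (n / (p - 1)) : ℕ) : ℝ) *
          ((N : ℝ) *
              ∑ q ∈ Finset.univ.filter
                  (fun q : Fin n → Fin N => (N : ℤ) ∣ ∑ j, ((q j : ℕ) : ℤ) * α j),
                ∏ j, periodicBernoulli 1 ((u j + ((q j : ℕ) : ℝ)) / N)
            - ∏ j, periodicBernoulli 1 (u j))
        = (z : ℝ) := by
  exact exists_int_prod_mul_smoothedSum_eq (by omega) hα u
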